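/- Let m be a positive integer. The face generating function G = F_{[−m;m]}(x,u) of the m-Catalan arrangements is the unique formal power series in ℚ[u][[x]] satisfying G = e^{−x} + (1+u)(1 − e^{−x})·G^{m+1}. -/

import Mathlib

open scoped BigOperators Classical

namespace Braid

def hyp (n : ℕ) (i j : Fin n) (s : ℝ) : Set (Fin n → ℝ) := {x | x i - x j = s}
def arrS (S : Set ℤ) (n : ℕ) : Set (Set (Fin n → ℝ)) :=
  {H | ∃ i j : Fin n, ∃ s : ℤ, i < j ∧ s ∈ S ∧ H = hyp n i j (s : ℝ)}
def IsSideOf (n : ℕ) (σ H : Set (Fin n → ℝ)) : Prop :=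
  σ = H ∨ ∃ (i j : Fin n) (s : ℝ), H = hyp n i j s ∧
    (σ = {x | x i - x j < s} ∨ σ = {x | s < x i - x j})
def IsFace (n : ℕ) (A : Set (Set (Fin n → ℝ))) (F : Set (Fin n → ℝ)) : Prop :=
  F.Nonempty ∧ ∃ σ : Set (Fin n → ℝ) → Set (Fin n → ℝ),
    (∀ H ∈ A, IsSideOf n (σ H) H) ∧ F = ⋂ H ∈ A, σ H
noncomputable def faceDim (n : ℕ) (F : Set (Fin n → ℝ)) : ℕ :=
  Module.finrank ℝ (affineSpan ℝ F).direction

/-- The number `c_{n,k}` of `k`-dimensional faces of `A_S^n`. -/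
noncomputable def faceCount (S : Set ℤ) (n k : ℕ) : ℕ :=
  Nat.card {F : Set (Fin n → ℝ) // IsFace n (arrS S n) F ∧ faceDim n F = k}

/-- The face generating function `F_S(x,u) ∈ ℚ[u][[x]]`. -/
noncomputable def FGF (S : Set ℤ) : PowerSeries (Polynomial ℚ) :=
  PowerSeries.mk fun n => Polynomial.C ((n.factorial : ℚ)⁻¹) *
    ∑ k ∈ Finset.range (n + 1), (faceCount S n k : ℚ) • Polynomial.X ^ k

/-- `e^x` in `ℚ[u][[x]]`. -/
noncomputable def Eexp : PowerSeries (Polynomial ℚ) :=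
  PowerSeries.mk fun n => Polynomial.C ((n.factorial : ℚ)⁻¹)

/-- `e^{-x}` in `ℚ[u][[x]]`. -/
noncomputable def EexpNeg : PowerSeries (Polynomial ℚ) :=
  PowerSeries.mk fun n => Polynomial.C ((-1 : ℚ) ^ n * (n.factorial : ℚ)⁻¹)

/-- The variable `u` as an element of `ℚ[u][[x]]`. -/
noncomputable def Useries : PowerSeries (Polynomial ℚ) := PowerSeries.C Polynomial.X

/-- `e^{xu}` in `ℚ[u][[x]]`. -/
noncomputable def Eexu : PowerSeries (Polynomial ℚ) :=
  PowerSeries.mk fun n => ((n.factorial : ℚ)⁻¹) • Polynomial.X ^ n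

/-- `e^{-xu}` in `ℚ[u][[x]]`. -/
noncomputable def EexuNeg : PowerSeries (Polynomial ℚ) :=
  PowerSeries.mk fun n => ((-1 : ℚ) ^ n * (n.factorial : ℚ)⁻¹) • Polynomial.X ^ n


/-! ### Combinatorial model -/

section Model
variable {ι : Type*}

/-- Two configurations compare in the same way (indices in `S`, pending event times in `P`). -/
def Rel (m : ℕ) (S : Finset ι) (P : Set ℝ) (x y : ι → ℝ) : Prop :=
  (∀ i ∈ S, ∀ j ∈ S, ∀ s : ℤ, s.natAbs ≤ m → (x i < x j + s ↔ y i < y j + s)) ∧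
  (∀ i ∈ S, ∀ p ∈ P, (x i < p ↔ y i < p) ∧ (p < x i ↔ p < y i))

def Pos (S : Finset ι) (c : ℝ) (x : ι → ℝ) : Prop := ∀ i ∈ S, c < x i

noncomputable def dval (m : ℕ) (S : Finset ι) (P : Set ℝ) (x : ι → ℝ) : ℕ :=
  ((S.image x).filter (fun v => v ∉ P ∧ ∀ j ∈ S, ∀ s : ℕ, 1 ≤ s → s ≤ m → v ≠ x j + s)).card

/-- There is a finite transversal of the classes of `R` on `Y`, with weighted count `p`. -/
def Cnt (Y : (ι → ℝ) → Prop) (R : (ι → ℝ) → (ι → ℝ) → Prop) (d : (ι → ℝ) → ℕ)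
    (p : Polynomial ℚ) : Prop :=
  ∃ T : Finset (ι → ℝ), (∀ t ∈ T, Y t) ∧ (∀ y, Y y → ∃ t ∈ T, R y t) ∧
    (∀ t ∈ T, ∀ t' ∈ T, R t t' → t = t') ∧ ∑ t ∈ T, Polynomial.X ^ (d t) = p

theorem Rel.refl (m : ℕ) (S : Finset ι) (P : Set ℝ) (x : ι → ℝ) : Rel m S P x x :=
  ⟨fun _ _ _ _ _ _ => Iff.rfl, fun _ _ _ _ => ⟨Iff.rfl, Iff.rfl⟩⟩

theorem Rel.symm {m : ℕ} {S : Finset ι} {P : Set ℝ} {x y : ι → ℝ} (h : Rel m S P x y) :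
    Rel m S P y x :=
  ⟨fun i hi j hj s hs => (h.1 i hi j hj s hs).symm,
    fun i hi p hp => ⟨(h.2 i hi p hp).1.symm, (h.2 i hi p hp).2.symm⟩⟩

theorem Rel.trans {m : ℕ} {S : Finset ι} {P : Set ℝ} {x y z : ι → ℝ} (h : Rel m S P x y)
    (h' : Rel m S P y z) : Rel m S P x z :=
  ⟨fun i hi j hj s hs => (h.1 i hi j hj s hs).trans (h'.1 i hi j hj s hs),
    fun i hi p hp => ⟨(h.2 i hi p hp).1.trans (h'.2 i hi p hp).1,
      (h.2 i hi p hp).2.trans (h'.2 i hi p hp).2⟩⟩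

theorem Cnt.iUnion {κ : Type*} {R : (ι → ℝ) → (ι → ℝ) → Prop} {d : (ι → ℝ) → ℕ}
    (hrefl : ∀ x, R x x)
    (K : Finset κ) (Y : (ι → ℝ) → Prop) (Yk : κ → (ι → ℝ) → Prop) (p : κ → Polynomial ℚ)
    (h : ∀ k ∈ K, Cnt (Yk k) R d (p k)) (hY : ∀ y, Y y ↔ ∃ k ∈ K, Yk k y)
    (hd : ∀ k ∈ K, ∀ k' ∈ K, ∀ y y', Yk k y → Yk k' y' → R y y' → k = k') :
    Cnt Y R d (∑ k ∈ K, p k) := by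
  choose! T h1 h2 h3 h4 using h
  refine ⟨K.biUnion T, ?_, ?_, ?_, ?_⟩
  · intro t ht
    obtain ⟨k, hk, hkt⟩ := Finset.mem_biUnion.1 ht
    exact (hY t).2 ⟨k, hk, h1 k hk t hkt⟩
  · intro y hy
    obtain ⟨k, hk, hky⟩ := (hY y).1 hy
    obtain ⟨t, ht, hR⟩ := h2 k hk y hky
    exact ⟨t, Finset.mem_biUnion.2 ⟨k, hk, ht⟩, hR⟩
  · intro t ht t' ht' hR
    obtain ⟨k, hk, hkt⟩ := Finset.mem_biUnion.1 ht
    obtain ⟨k', hk', hkt'⟩ := Finset.mem_biUnion.1 ht'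
    obtain rfl := hd k hk k' hk' t t' (h1 k hk t hkt) (h1 k' hk' t' hkt') hR
    exact h3 k hk t hkt t' hkt' hR
  · rw [Finset.sum_biUnion]
    · exact Finset.sum_congr rfl h4
    · intro k hk k' hk' hne
      refine Finset.disjoint_left.2 fun t ht ht' => hne ?_
      exact hd k hk k' hk' t t (h1 k hk t ht) (h1 k' hk' t ht') (hrefl t)

theorem Cnt.union {R : (ι → ℝ) → (ι → ℝ) → Prop} {d : (ι → ℝ) → ℕ} (hrefl : ∀ x, R x x)
    (hsymm : ∀ x y, R x y → R y x)
    {Y Y1 Y2 : (ι → ℝ) → Prop} {p q : Polynomial ℚ}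
    (h1 : Cnt Y1 R d p) (h2 : Cnt Y2 R d q) (hY : ∀ y, Y y ↔ Y1 y ∨ Y2 y)
    (hd : ∀ y y', Y1 y → Y2 y' → ¬ R y y') : Cnt Y R d (p + q) := by
  have := Cnt.iUnion (R := R) (d := d) hrefl (Finset.univ : Finset Bool) Y
    (fun b => if b then Y1 else Y2) (fun b => if b then p else q)
    (by intro k _; cases k <;> simpa) (by intro y; simp [hY, or_comm])
    (by
      intro k _ k' _ y y' hk hk' hR
      cases k <;> cases k' <;> simp at hk hk' ⊢
      · exact hd _ _ hk' hk (hsymm _ _ hR)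
      · exact hd _ _ hk hk' hR)
  simpa using this

theorem Cnt.map {R R' : (ι → ℝ) → (ι → ℝ) → Prop} {d d' : (ι → ℝ) → ℕ}
    {Y Y' : (ι → ℝ) → Prop} {p : Polynomial ℚ} (h : Cnt Y' R' d' p)
    (e : (ι → ℝ) → (ι → ℝ)) (a : ℕ)
    (he : ∀ t, Y' t → Y (e t))
    (hinj : ∀ t t', Y' t → Y' t' → e t = e t' → R' t t')
    (hR : ∀ t t', Y' t → Y' t' → R (e t) (e t') → R' t t')
    (hs : ∀ y, Y y → ∃ y', Y' y' ∧ ∀ t', Y' t' → R' y' t' → R y (e t'))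
    (hd : ∀ t, Y' t → d (e t) = a + d' t) :
    Cnt Y R d (Polynomial.X ^ a * p) := by
  obtain ⟨T, h1, h2, h3, rfl⟩ := h
  refine ⟨T.image e, ?_, ?_, ?_, ?_⟩
  · intro t ht
    obtain ⟨s, hs, rfl⟩ := Finset.mem_image.1 ht
    exact he s (h1 s hs)
  · intro y hy
    obtain ⟨y', hy', h⟩ := hs y hy
    obtain ⟨t, ht, htR⟩ := h2 y' hy'
    exact ⟨e t, Finset.mem_image_of_mem e ht, h t (h1 t ht) htR⟩
  · intro t ht t' ht' hR'
    obtain ⟨s, hs, rfl⟩ := Finset.mem_image.1 ht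
    obtain ⟨s', hs', rfl⟩ := Finset.mem_image.1 ht'
    rw [h3 s hs s' hs' (hR s s' (h1 s hs) (h1 s' hs') hR')]
  · rw [Finset.sum_image, Finset.mul_sum]
    · refine Finset.sum_congr rfl fun t ht => ?_
      rw [hd t (h1 t ht), pow_add]
    · intro s hs s' hs' heq
      exact h3 s hs s' hs' (hinj s s' (h1 s hs) (h1 s' hs') heq)

/-- Put the block `B` at time `v`. -/
noncomputable def ext (B : Finset ι) (v : ℝ) (t : ι → ℝ) : ι → ℝ := fun i => if i ∈ B then v else t i

theorem rel_ext_iff {m : ℕ} {S B : Finset ι} {P P' : Set ℝ} {v : ℝ} (hB : B ⊆ S)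
    (hBn : B.Nonempty)
    (hP : ∀ w ∈ P, v ≤ w) (hP' : ∀ w ∈ P', v < w)
    (H : ∀ w, v < w → (w ∈ P' ↔ w ∈ P ∨ ∃ s : ℕ, 1 ≤ s ∧ s ≤ m ∧ w = v + s))
    {t t' : ι → ℝ} (ht : Pos (S \ B) v t) (ht' : Pos (S \ B) v t') :
    Rel m S P (ext B v t) (ext B v t') ↔ Rel m (S \ B) P' t t' := by
  obtain ⟨b, hb⟩ := hBn
  have key : ∀ s : ℕ, 1 ≤ s → s ≤ m → v + (s : ℝ) ∈ P' := fun s h1 h2 =>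
    (H _ (by have : (1:ℝ) ≤ s := by exact_mod_cast h1
             linarith)).2 (Or.inr ⟨s, h1, h2, rfl⟩)
  constructor
  · rintro ⟨h1, h2⟩
    refine ⟨?_, ?_⟩
    · intro i hi j hj s hs
      rw [Finset.mem_sdiff] at hi hj
      simpa [ext, hi.2, hj.2] using h1 i hi.1 j hj.1 s hs
    · intro i hi p hp
      rw [Finset.mem_sdiff] at hi
      rcases (H p (hP' p hp)).1 hp with hp | ⟨s, hs1, hs2, rfl⟩
      · simpa [ext, hi.2] using h2 i hi.1 p hp
      · have a1 := h1 i hi.1 b (hB hb) s (by simpa using hs2)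
        have a2 := h1 b (hB hb) i hi.1 (-s) (by simpa using hs2)
        simp only [ext, hi.2, hb, if_true, if_false, Int.cast_neg, Int.cast_natCast] at a1 a2
        refine ⟨a1, ?_⟩
        constructor
        · intro h; have := a2.1 (by linarith); linarith
        · intro h; have := a2.2 (by linarith); linarith
  · rintro ⟨h1, h2⟩
    have cmp1 : ∀ i ∈ S \ B, ∀ s : ℤ, s.natAbs ≤ m → (t i < v + s ↔ t' i < v + s) := by
      intro i hi s hs
      rcases le_or_gt s 0 with h0 | h0
      · have h0' : (s : ℝ) ≤ 0 := by exact_mod_cast h0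
        have := ht i hi; have := ht' i hi
        constructor <;> intro <;> linarith
      · obtain ⟨k, rfl⟩ := Int.eq_ofNat_of_zero_le h0.le
        have := (h2 i hi _ (key k (by omega) (by simpa using hs))).1
        simpa using this
    have cmp2 : ∀ i ∈ S \ B, ∀ s : ℤ, s.natAbs ≤ m → (v < t i + s ↔ v < t' i + s) := by
      intro i hi s hs
      rcases le_or_gt 0 s with h0 | h0
      · have h0' : (0 : ℝ) ≤ s := by exact_mod_cast h0
        have := ht i hi; have := ht' i hi
        constructor <;> intro <;> linarith
      · obtain ⟨k, hk⟩ := Int.eq_ofNat_of_zero_le (a := -s) (by omega)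
        obtain rfl : s = -k := by omega
        have := (h2 i hi _ (key k (by omega) (by simpa using hs))).2
        push_cast
        constructor
        · intro h; have := this.1 (by linarith); linarith
        · intro h; have := this.2 (by linarith); linarith
    refine ⟨?_, ?_⟩
    · intro i hi j hj s hs
      by_cases hiB : i ∈ B <;> by_cases hjB : j ∈ B <;> simp only [ext, hiB, hjB, if_true, if_false]
      · exact cmp2 j (Finset.mem_sdiff.2 ⟨hj, hjB⟩) s hs
      · exact cmp1 i (Finset.mem_sdiff.2 ⟨hi, hiB⟩) s hs
      · exact h1 i (Finset.mem_sdiff.2 ⟨hi, hiB⟩) j (Finset.mem_sdiff.2 ⟨hj, hjB⟩) s hs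
    · intro i hi p hp
      by_cases hiB : i ∈ B <;> simp only [ext, hiB, if_true, if_false]
      · simp
      · have hi' := Finset.mem_sdiff.2 ⟨hi, hiB⟩
        rcases (hP p hp).eq_or_lt with rfl | hlt
        · have := ht i hi'; have := ht' i hi'
          constructor <;> constructor <;> intro <;> linarith
        · exact h2 i hi' p ((H p hlt).2 (Or.inl hp))

theorem dval_ext {m : ℕ} {S B : Finset ι} {P P' : Set ℝ} {v : ℝ} (hB : B ⊆ S)
    (hBn : B.Nonempty)
    (H : ∀ w, v < w → (w ∈ P' ↔ w ∈ P ∨ ∃ s : ℕ, 1 ≤ s ∧ s ≤ m ∧ w = v + s))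
    {t : ι → ℝ} (ht : Pos (S \ B) v t) :
    dval m S P (ext B v t) = (if v ∈ P then 0 else 1) + dval m (S \ B) P' t := by
  have hge : ∀ j ∈ S, v ≤ ext B v t j := by
    intro j hj
    by_cases hjB : j ∈ B
    · simp [ext, hjB]
    · simpa [ext, hjB] using (ht j (Finset.mem_sdiff.2 ⟨hj, hjB⟩)).le
  obtain ⟨b, hb⟩ := hBn
  have himg : S.image (ext B v t) = insert v ((S \ B).image t) := by
    ext w
    simp only [Finset.mem_image, Finset.mem_insert, Finset.mem_sdiff]
    constructor
    · rintro ⟨i, hi, rfl⟩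
      by_cases hiB : i ∈ B
      · left; simp [ext, hiB]
      · right; exact ⟨i, ⟨hi, hiB⟩, by simp [ext, hiB]⟩
    · rintro (rfl | ⟨i, ⟨hi, hiB⟩, rfl⟩)
      · exact ⟨b, hB hb, by simp [ext, hb]⟩
      · exact ⟨i, hi, by simp [ext, hiB]⟩
  have hvfree : ∀ j ∈ S, ∀ s : ℕ, 1 ≤ s → s ≤ m → v ≠ ext B v t j + s := by
    intro j hj s hs _ h
    have := hge j hj
    have : (1:ℝ) ≤ s := by exact_mod_cast hs
    linarith
  have hnot : v ∉ (S \ B).image t := by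
    intro h
    obtain ⟨i, hi, h⟩ := Finset.mem_image.1 h
    have := ht i hi
    linarith
  have hfil : ((S \ B).image t).filter
        (fun w => w ∉ P ∧ ∀ j ∈ S, ∀ s : ℕ, 1 ≤ s → s ≤ m → w ≠ ext B v t j + s)
      = ((S \ B).image t).filter
        (fun w => w ∉ P' ∧ ∀ j ∈ S \ B, ∀ s : ℕ, 1 ≤ s → s ≤ m → w ≠ t j + s) := by
    apply Finset.filter_congr
    intro w hw
    obtain ⟨i, hi, rfl⟩ := Finset.mem_image.1 hw
    rw [H _ (ht i hi)]
    constructor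
    · rintro ⟨h1, h2⟩
      refine ⟨?_, ?_⟩
      · rintro (h | ⟨s, hs1, hs2, h⟩)
        · exact h1 h
        · exact h2 b (hB hb) s hs1 hs2 (by simpa [ext, hb] using h)
      · intro j hj s hs1 hs2
        have hj' := Finset.mem_sdiff.1 hj
        simpa [ext, hj'.2] using h2 j hj'.1 s hs1 hs2
    · rintro ⟨h1, h2⟩
      refine ⟨fun h => h1 (Or.inl h), ?_⟩
      intro j hj s hs1 hs2
      by_cases hjB : j ∈ B
      · simp only [ext, hjB, if_true]
        exact fun h => h1 (Or.inr ⟨s, hs1, hs2, h⟩)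
      · simpa [ext, hjB] using h2 j (Finset.mem_sdiff.2 ⟨hj, hjB⟩) s hs1 hs2
  unfold dval
  rw [himg, Finset.filter_insert, hfil]
  by_cases hv : v ∈ P
  · simp [hv]
  · rw [if_pos ⟨hv, hvfree⟩, Finset.card_insert_of_notMem, if_neg hv, add_comm]
    intro h; exact hnot (Finset.mem_filter.1 h).1

end Model

/-! ### Circle reparametrisations -/

theorem exists_psi (κ α β : ℝ) (h0 : 0 ≤ κ) (h1 : κ < α) (h2 : α < 1) (h3 : κ < β) (h4 : β < 1) :
    ∃ ψ : ℝ → ℝ, (∀ f, 0 ≤ f → f < 1 → 0 ≤ ψ f ∧ ψ f < 1) ∧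
      (∀ f g, f < g → g < 1 → ψ f < ψ g) ∧ (∀ f, f ≤ κ → ψ f = f) ∧ ψ α = β := by
  have hr : 0 < (β - κ) / (α - κ) := div_pos (by linarith) (by linarith)
  have hr' : 0 < (1 - β) / (1 - α) := div_pos (by linarith) (by linarith)
  have e1 : (α - κ) * ((β - κ) / (α - κ)) = β - κ := mul_div_cancel₀ _ (by linarith)
  have e2 : (1 - α) * ((1 - β) / (1 - α)) = 1 - β := mul_div_cancel₀ _ (by linarith)
  set r := (β - κ) / (α - κ)
  set r' := (1 - β) / (1 - α)
  set ψ : ℝ → ℝ := fun f => if f ≤ κ then f else if f ≤ α then κ + (f - κ) * r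
    else 1 - (1 - f) * r' with hψ
  have hmono : ∀ f g, f < g → ψ f < ψ g := by
    intro f g hfg
    simp only [hψ]
    split_ifs <;> nlinarith
  have hid : ∀ f, f ≤ κ → ψ f = f := fun f hf => by simp [hψ, hf]
  have hone : ψ 1 = 1 := by
    simp only [hψ]
    rw [if_neg (by linarith), if_neg (by linarith)]; ring
  refine ⟨ψ, ?_, fun f g h _ => hmono f g h, hid, ?_⟩
  · intro f hf0 hf1
    constructor
    · rcases hf0.eq_or_lt with rfl | h
      · rw [hid 0 h0]
      · have := hmono _ _ h
        rw [hid 0 h0] at this; exact this.le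
    · have := hmono _ _ hf1
      rwa [hone] at this
  · simp only [hψ]
    rw [if_neg (by linarith), if_pos le_rfl]; linarith

/-- Set of event times of a queue of batches (next time, remaining number of events). -/
def PL (L : List (ℝ × ℕ)) : Set ℝ := {q | ∃ a ∈ L, ∃ t : ℕ, t < a.2 ∧ q = a.1 + t}

def Valid (m : ℕ) (c : ℝ) (L : List (ℝ × ℕ)) : Prop :=
  L.Pairwise (fun a b => a.1 < b.1) ∧ ∀ a ∈ L, c < a.1 ∧ a.1 ≤ c + 1 ∧ 1 ≤ a.2 ∧ a.2 ≤ m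

theorem exists_phi {m : ℕ} {c : ℝ} {L : List (ℝ × ℕ)} (hL : Valid m c L) {v v0 : ℝ}
    (hv : c < v) (hv0 : c < v0) (hvP : ∀ q ∈ PL L, v < q) (hv0P : ∀ q ∈ PL L, v0 < q) :
    ∃ φ : ℝ → ℝ, StrictMono φ ∧ (∀ x (s : ℤ), φ (x + s) = φ x + s) ∧
      (∀ q ∈ PL L, φ q = q) ∧ φ v = v0 := by
  cases L with
  | nil =>
    refine ⟨fun x => x + (v0 - v), fun x y h => by simpa using h, fun x s => by ring, ?_, by ring⟩
    rintro q ⟨a, ha, _⟩; simp at ha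
  | cons a L =>
    obtain ⟨hL1, hL2⟩ := hL
    rw [List.pairwise_cons] at hL1
    have ha := hL2 a (by simp)
    have hap : a.1 ∈ PL (a :: L) := ⟨a, by simp, 0, by omega, by simp⟩
    have hva := hvP _ hap
    have hv0a := hv0P _ hap
    set p := a.1 with hp
    obtain ⟨ψ, hψ1, hψ2, hψ3, hψ4⟩ := exists_psi (c + 1 - p) (v - p + 1) (v0 - p + 1)
      (by linarith) (by linarith) (by linarith) (by linarith) (by linarith)
    have hfr : ∀ x : ℝ, 0 ≤ ψ (Int.fract x) ∧ ψ (Int.fract x) < 1 := fun x =>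
      hψ1 _ (Int.fract_nonneg x) (Int.fract_lt_one x)
    refine ⟨fun x => ⌊x - p⌋ + p + ψ (Int.fract (x - p)), ?_, ?_, ?_, ?_⟩
    · intro x y hxy
      have hxy' : x - p < y - p := by linarith
      have hfl : ⌊x - p⌋ ≤ ⌊y - p⌋ := Int.floor_le_floor hxy'.le
      show (⌊x - p⌋ : ℝ) + p + ψ (Int.fract (x - p)) < ⌊y - p⌋ + p + ψ (Int.fract (y - p))
      rcases hfl.eq_or_lt with h | h
      · have h1 := Int.floor_add_fract (x - p)
        have h2 := Int.floor_add_fract (y - p)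
        have h3 : (⌊x - p⌋ : ℝ) = ⌊y - p⌋ := by rw [h]
        have := hψ2 (Int.fract (x - p)) (Int.fract (y - p)) (by linarith) (Int.fract_lt_one _)
        linarith
      · have h3 : (⌊x - p⌋ : ℝ) + 1 ≤ ⌊y - p⌋ := by exact_mod_cast h
        have := hfr (x - p); have := hfr (y - p)
        linarith
    · intro x s
      have : x + s - p = x - p + s := by ring
      simp only [this, Int.floor_add_intCast, Int.fract_add_intCast]
      push_cast; ring
    · rintro q ⟨b, hb, t, ht, rfl⟩
      have hb2 := hL2 b hb
      have hpb : p ≤ b.1 := by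
        rcases List.mem_cons.1 hb with rfl | hb
        · exact le_rfl
        · exact (hL1.1 b hb).le
      have e : b.1 + (t : ℝ) - p = b.1 - p + (t : ℤ) := by push_cast; ring
      have hf : ⌊b.1 - p⌋ = 0 := Int.floor_eq_zero_iff.2 ⟨by linarith, by linarith⟩
      have hf' : Int.fract (b.1 - p) = b.1 - p := by
        have := Int.floor_add_fract (b.1 - p)
        rw [hf] at this; push_cast at this; linarith
      simp only [e, Int.floor_add_intCast, Int.fract_add_intCast, hf, hf']
      rw [hψ3 _ (by linarith)]
      push_cast; ring
    · have hf : ⌊v - p⌋ = -1 := Int.floor_eq_iff.2 ⟨by push_cast; linarith, by push_cast; linarith⟩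
      have hf' : Int.fract (v - p) = v - p + 1 := by
        have := Int.floor_add_fract (v - p)
        rw [hf] at this; push_cast at this; linarith
      simp only [hf, hf', hψ4]
      push_cast; ring

/-! ### The recursion on states -/

section Steps
variable {ι : Type*}

def YF (c : ℝ) (P : Set ℝ) (S B : Finset ι) (y : ι → ℝ) : Prop :=
  ∃ v, c < v ∧ (∀ q ∈ P, v < q) ∧ (∀ i ∈ B, y i = v) ∧ Pos (S \ B) v y

def YA (p : ℝ) (S B : Finset ι) (y : ι → ℝ) : Prop :=
  (∀ i ∈ B, y i = p) ∧ Pos (S \ B) p y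

abbrev CntS (m : ℕ) (S : Finset ι) (c : ℝ) (L : List (ℝ × ℕ)) (p : Polynomial ℚ) : Prop :=
  Cnt (Pos S c) (Rel m S (PL L)) (dval m S (PL L)) p

theorem PL_append (L L' : List (ℝ × ℕ)) (w : ℝ) : w ∈ PL (L ++ L') ↔ w ∈ PL L ∨ w ∈ PL L' := by
  simp only [PL, List.mem_append, Set.mem_ofPred_eq]
  constructor
  · rintro ⟨a, ha | ha, h⟩
    · exact Or.inl ⟨a, ha, h⟩
    · exact Or.inr ⟨a, ha, h⟩
  · rintro (⟨a, ha, h⟩ | ⟨a, ha, h⟩)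
    · exact ⟨a, Or.inl ha, h⟩
    · exact ⟨a, Or.inr ha, h⟩

theorem PL_single (p : ℝ) (l : ℕ) (w : ℝ) : w ∈ PL [(p, l)] ↔ ∃ t : ℕ, t < l ∧ w = p + t := by
  simp [PL]

theorem PL_single_succ (p : ℝ) (l : ℕ) (w : ℝ) :
    w ∈ PL [(p + 1, l)] ↔ ∃ s : ℕ, 1 ≤ s ∧ s ≤ l ∧ w = p + s := by
  rw [PL_single]
  constructor
  · rintro ⟨t, ht, rfl⟩
    exact ⟨t + 1, by omega, by omega, by push_cast; ring⟩
  · rintro ⟨s, h1, h2, rfl⟩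
    obtain ⟨t, rfl⟩ := Nat.exists_eq_add_of_le h1
    exact ⟨t, by omega, by push_cast; ring⟩

theorem PL_lt {m : ℕ} {c : ℝ} {L : List (ℝ × ℕ)} (hL : Valid m c L) : ∀ q ∈ PL L, c < q := by
  rintro q ⟨a, ha, t, ht, rfl⟩
  have := hL.2 a ha
  have : (0:ℝ) ≤ t := Nat.cast_nonneg t
  linarith

theorem Valid.snoc {m : ℕ} {c c' p : ℝ} {L : List (ℝ × ℕ)} {l : ℕ} (hc : c < c')
    (hL : Valid m c L) (h : ∀ a ∈ L, c' < a.1) (hl : 1 ≤ l) (hl' : l ≤ m) (hp : p = c' + 1) :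
    Valid m c' (L ++ [(p, l)]) := by
  subst hp
  refine ⟨?_, ?_⟩
  · rw [List.pairwise_append]
    refine ⟨hL.1, by simp, ?_⟩
    intro a ha b hb
    simp only [List.mem_singleton] at hb
    subst hb
    have := hL.2 a ha
    simp only; linarith
  · intro a ha
    rw [List.mem_append, List.mem_singleton] at ha
    rcases ha with ha | rfl
    · have := hL.2 a ha
      exact ⟨h a ha, by linarith, this.2.2.1, this.2.2.2⟩
    · exact ⟨by simp, le_rfl, hl, hl'⟩

theorem Valid.tail {m : ℕ} {c : ℝ} {a : ℝ × ℕ} {L : List (ℝ × ℕ)} (hL : Valid m c (a :: L)) :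
    Valid m c L ∧ ∀ b ∈ L, a.1 < b.1 :=
  ⟨⟨(List.pairwise_cons.1 hL.1).2, fun b hb => hL.2 b (List.mem_cons_of_mem _ hb)⟩,
    (List.pairwise_cons.1 hL.1).1⟩

theorem Valid.mono {m : ℕ} {c c' : ℝ} {L : List (ℝ × ℕ)} (hL : Valid m c L) (hc : c ≤ c')
    (h : ∀ a ∈ L, c' < a.1) : Valid m c' L :=
  ⟨hL.1, fun a ha => ⟨h a ha, by have := hL.2 a ha; linarith, (hL.2 a ha).2.2⟩⟩

theorem ext_self {B : Finset ι} {v : ℝ} {y : ι → ℝ} (h : ∀ i ∈ B, y i = v) : ext B v y = y := by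
  funext i
  by_cases hi : i ∈ B
  · simp [ext, hi, h i hi]
  · simp [ext, hi]

theorem rel_phi {m : ℕ} {S : Finset ι} {P : Set ℝ} {φ : ℝ → ℝ} (h1 : StrictMono φ)
    (h2 : ∀ x (s : ℤ), φ (x + s) = φ x + s) (h3 : ∀ q ∈ P, φ q = q) (y : ι → ℝ) :
    Rel m S P y (φ ∘ y) := by
  refine ⟨fun i _ j _ s _ => ?_, fun i _ p hp => ⟨?_, ?_⟩⟩
  · rw [Function.comp, Function.comp, ← h2, h1.lt_iff_lt]
  · conv_rhs => rw [← h3 p hp]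
    exact h1.lt_iff_lt.symm
  · conv_rhs => rw [← h3 p hp]
    exact h1.lt_iff_lt.symm

theorem cnt_free {m : ℕ} {c v0 : ℝ} {L : List (ℝ × ℕ)} (hL : Valid m c L) (hv0 : c < v0)
    (hv0P : ∀ q ∈ PL L, v0 < q) {S B : Finset ι} (hB : B ⊆ S) (hBn : B.Nonempty)
    {p : Polynomial ℚ} (h : CntS m (S \ B) v0 (L ++ [(v0 + 1, m)]) p) :
    Cnt (YF c (PL L) S B) (Rel m S (PL L)) (dval m S (PL L)) (Polynomial.X ^ 1 * p) := by
  have H : ∀ w, v0 < w → (w ∈ PL (L ++ [(v0 + 1, m)]) ↔ w ∈ PL L ∨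
      ∃ s : ℕ, 1 ≤ s ∧ s ≤ m ∧ w = v0 + s) := by
    intro w _
    rw [PL_append, PL_single_succ]
  have hP' : ∀ w ∈ PL (L ++ [(v0 + 1, m)]), v0 < w := by
    intro w hw
    rw [PL_append, PL_single_succ] at hw
    rcases hw with hw | ⟨s, hs, _, rfl⟩
    · exact hv0P w hw
    · have : (1:ℝ) ≤ s := by exact_mod_cast hs
      linarith
  have hP : ∀ w ∈ PL L, v0 ≤ w := fun w hw => (hv0P w hw).le
  have iff := fun (t t' : ι → ℝ) (ht : Pos (S \ B) v0 t) (ht' : Pos (S \ B) v0 t') =>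
    rel_ext_iff (m := m) hB hBn hP hP' H ht ht'
  refine h.map (ext B v0) 1 ?_ ?_ ?_ ?_ ?_
  · intro t ht
    refine ⟨v0, hv0, hv0P, fun i hi => by simp [ext, hi], fun i hi => ?_⟩
    have := ht i hi
    simpa [ext, (Finset.mem_sdiff.1 hi).2] using this
  · intro t t' ht ht' he
    rw [← iff t t' ht ht', he]
    exact Rel.refl _ _ _ _
  · intro t t' ht ht' hR
    exact (iff t t' ht ht').1 hR
  · rintro y ⟨v, hv, hvP, hvB, hpos⟩
    obtain ⟨φ, h1, h2, h3, h4⟩ := exists_phi hL hv hv0 hvP hv0P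
    have hpos' : Pos (S \ B) v0 (φ ∘ y) := fun i hi => by
      rw [← h4]; exact h1 (hpos i hi)
    refine ⟨φ ∘ y, hpos', fun t' ht' hR => (rel_phi h1 h2 h3 y).trans ?_⟩
    have := (iff _ t' hpos' ht').2 hR
    rwa [ext_self] at this
    intro i hi
    simp [hvB i hi, h4]
  · intro t ht
    rw [dval_ext hB hBn H ht, if_neg]
    exact fun h => lt_irrefl _ (hv0P _ h)

theorem cnt_at {m : ℕ} {c : ℝ} {a : ℝ × ℕ} {L : List (ℝ × ℕ)} (hL : Valid m c (a :: L))
    {S B : Finset ι} (hB : B ⊆ S) (hBn : B.Nonempty)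
    {p : Polynomial ℚ} (h : CntS m (S \ B) a.1 (L ++ [(a.1 + 1, m)]) p) :
    Cnt (YA a.1 S B) (Rel m S (PL (a :: L))) (dval m S (PL (a :: L))) p := by
  have ha := hL.2 a (by simp)
  have hcons : ∀ w, w ∈ PL (a :: L) ↔ w ∈ PL [a] ∨ w ∈ PL L := fun w => PL_append [a] L w
  have htl : ∀ w ∈ PL L, a.1 < w := PL_lt (hL.tail.1.mono ha.1.le hL.tail.2)
  have hsing : ∀ w, w ∈ PL [a] ↔ ∃ t : ℕ, t < a.2 ∧ w = a.1 + t := fun w => PL_single a.1 a.2 w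
  have H : ∀ w, a.1 < w → (w ∈ PL (L ++ [(a.1 + 1, m)]) ↔ w ∈ PL (a :: L) ∨
      ∃ s : ℕ, 1 ≤ s ∧ s ≤ m ∧ w = a.1 + s) := by
    intro w hw
    rw [PL_append, PL_single_succ, hcons, hsing]
    constructor
    · rintro (h | h)
      · exact Or.inl (Or.inr h)
      · exact Or.inr h
    · rintro ((⟨t, ht, rfl⟩ | h) | h)
      · right
        refine ⟨t, ?_, by omega, rfl⟩
        rcases Nat.eq_zero_or_pos t with rfl | h
        · simp at hw
        · exact h
      · exact Or.inl h
      · exact Or.inr h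
  have hP' : ∀ w ∈ PL (L ++ [(a.1 + 1, m)]), a.1 < w := by
    intro w hw
    rw [PL_append, PL_single_succ] at hw
    rcases hw with hw | ⟨s, hs, _, rfl⟩
    · exact htl w hw
    · have : (1:ℝ) ≤ s := by exact_mod_cast hs
      linarith
  have hP : ∀ w ∈ PL (a :: L), a.1 ≤ w := by
    intro w hw
    rw [hcons, hsing] at hw
    rcases hw with ⟨t, _, rfl⟩ | hw
    · simp
    · exact (htl w hw).le
  have iff := fun (t t' : ι → ℝ) (ht : Pos (S \ B) a.1 t) (ht' : Pos (S \ B) a.1 t') =>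
    rel_ext_iff (m := m) hB hBn hP hP' H ht ht'
  have := h.map (R := Rel m S (PL (a :: L))) (d := dval m S (PL (a :: L))) (Y := YA a.1 S B)
    (ext B a.1) 0 ?_ ?_ ?_ ?_ ?_
  · simpa using this
  · intro t ht
    refine ⟨fun i hi => by simp [ext, hi], fun i hi => ?_⟩
    have := ht i hi
    simpa [ext, (Finset.mem_sdiff.1 hi).2] using this
  · intro t t' ht ht' he
    rw [← iff t t' ht ht', he]
    exact Rel.refl _ _ _ _
  · intro t t' ht ht' hR
    exact (iff t t' ht ht').1 hR
  · rintro y ⟨hvB, hpos⟩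
    refine ⟨y, hpos, fun t' ht' hR => ?_⟩
    have := (iff _ t' hpos ht').2 hR
    rwa [ext_self hvB] at this
  · intro t ht
    rw [dval_ext hB hBn H ht, if_pos]
    rw [hcons, hsing]
    exact Or.inl ⟨0, by omega, by simp⟩

theorem cnt_pop {m : ℕ} {c : ℝ} {a : ℝ × ℕ} {L L' : List (ℝ × ℕ)} (hL : Valid m c (a :: L))
    {S : Finset ι} (hL' : L' = if a.2 = 1 then L else L ++ [(a.1 + 1, a.2 - 1)])
    {p : Polynomial ℚ} (h : CntS m S a.1 L' p) :
    Cnt (YA a.1 S ∅) (Rel m S (PL (a :: L))) (dval m S (PL (a :: L))) p := by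
  have ha := hL.2 a (by simp)
  have H : ∀ w, w ∈ PL (a :: L) ↔ w = a.1 ∨ w ∈ PL L' := by
    intro w
    have e1 : w ∈ PL (a :: L) ↔ w ∈ PL [a] ∨ w ∈ PL L := PL_append [a] L w
    have e2 : w ∈ PL [a] ↔ ∃ t : ℕ, t < a.2 ∧ w = a.1 + t := PL_single a.1 a.2 w
    have e3 : w ∈ PL L' ↔ w ∈ PL L ∨ ∃ s : ℕ, 1 ≤ s ∧ s ≤ a.2 - 1 ∧ w = a.1 + s := by
      rw [hL']
      split_ifs with h1
      · simp only [h1]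
        constructor
        · exact Or.inl
        · rintro (h | ⟨s, h1, h2, _⟩)
          · exact h
          · omega
      · rw [PL_append, PL_single_succ]
    rw [e1, e2, e3]
    constructor
    · rintro (⟨t, ht, rfl⟩ | h)
      · rcases Nat.eq_zero_or_pos t with rfl | h
        · left; simp
        · right; right; exact ⟨t, h, by omega, rfl⟩
      · exact Or.inr (Or.inl h)
    · rintro (rfl | h | ⟨s, h1, h2, rfl⟩)
      · left; exact ⟨0, by omega, by simp⟩
      · exact Or.inr h
      · left
        have h3 : a.2 - 1 < a.2 := Nat.sub_lt ha.2.2.1 one_pos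
        exact ⟨s, h2.trans_lt h3, rfl⟩
  have iff : ∀ (t t' : ι → ℝ), Pos S a.1 t → Pos S a.1 t' →
      (Rel m S (PL (a :: L)) t t' ↔ Rel m S (PL L') t t') := by
    intro t t' ht ht'
    constructor
    · exact fun h => ⟨h.1, fun i hi q hq => h.2 i hi q ((H q).2 (Or.inr hq))⟩
    · refine fun h => ⟨h.1, fun i hi q hq => ?_⟩
      rcases (H q).1 hq with rfl | hq
      · have := ht i hi; have := ht' i hi
        constructor <;> constructor <;> intro <;> linarith
      · exact h.2 i hi q hq
  have := h.map (R := Rel m S (PL (a :: L))) (d := dval m S (PL (a :: L))) (Y := YA a.1 S ∅)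
    id 0 ?_ ?_ ?_ ?_ ?_
  · simpa using this
  · intro t ht
    exact ⟨by simp, by simpa using ht⟩
  · rintro t t' ht ht' he
    obtain rfl : t = t' := he
    exact Rel.refl _ _ _ _
  · intro t t' ht ht' hR
    exact (iff t t' ht ht').1 hR
  · rintro y ⟨_, hpos⟩
    have hpos : Pos S a.1 y := by simpa using hpos
    exact ⟨y, hpos, fun t' ht' hR => (iff _ t' hpos ht').2 hR⟩
  · intro t ht
    unfold dval
    rw [zero_add]
    congr 1
    apply Finset.filter_congr
    intro w hw
    obtain ⟨i, hi, rfl⟩ := Finset.mem_image.1 hw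
    have := ht i hi
    simp only [id, H]
    constructor
    · exact fun h => ⟨fun h' => h.1 (Or.inr h'), h.2⟩
    · refine fun h => ⟨?_, h.2⟩
      rintro (h' | h')
      · linarith
      · exact h.1 h'

theorem Rel.le_iff {m : ℕ} {S : Finset ι} {P : Set ℝ} {x y : ι → ℝ} (h : Rel m S P x y)
    {i j : ι} (hi : i ∈ S) (hj : j ∈ S) : x i ≤ x j ↔ y i ≤ y j := by
  have := h.1 j hj i hi 0 (by simp)
  simp only [Int.cast_zero, add_zero] at this
  rw [← not_lt, this, not_lt]

/-- the union of the free first events -/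
theorem cnt_free_union {m : ℕ} {c v0 : ℝ} {L : List (ℝ × ℕ)} (hL : Valid m c L) (hv0 : c < v0)
    (hv0P : ∀ q ∈ PL L, v0 < q) {S : Finset ι} {p : Finset ι → Polynomial ℚ}
    (h : ∀ B ∈ S.powerset.erase ∅, CntS m (S \ B) v0 (L ++ [(v0 + 1, m)]) (p B)) :
    Cnt (fun y => ∃ B ∈ S.powerset.erase ∅, YF c (PL L) S B y) (Rel m S (PL L))
      (dval m S (PL L)) (∑ B ∈ S.powerset.erase ∅, Polynomial.X ^ 1 * p B) := by
  refine Cnt.iUnion (Rel.refl _ _ _) _ _ (fun B => YF c (PL L) S B) _ ?_ (fun y => Iff.rfl) ?_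
  · intro B hB
    have hB' := Finset.mem_erase.1 hB
    exact cnt_free hL hv0 hv0P (Finset.mem_powerset.1 hB'.2)
      (Finset.nonempty_iff_ne_empty.2 hB'.1) (h B hB)
  · have key : ∀ B ∈ S.powerset.erase ∅, ∀ y, YF c (PL L) S B y →
        B = S.filter (fun i => ∀ j ∈ S, y i ≤ y j) := by
      rintro B hB y ⟨v, _, _, h1, h2⟩
      have hB' := Finset.mem_erase.1 hB
      have hBS := Finset.mem_powerset.1 hB'.2
      obtain ⟨b, hb⟩ := Finset.nonempty_iff_ne_empty.2 hB'.1
      ext i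
      rw [Finset.mem_filter]
      constructor
      · intro hi
        refine ⟨hBS hi, fun j hj => ?_⟩
        rw [h1 i hi]
        by_cases hjB : j ∈ B
        · exact (h1 j hjB).ge
        · exact (h2 j (Finset.mem_sdiff.2 ⟨hj, hjB⟩)).le
      · rintro ⟨hi, hmin⟩
        by_contra hiB
        have a1 := h2 i (Finset.mem_sdiff.2 ⟨hi, hiB⟩)
        have a2 := hmin b (hBS hb)
        rw [h1 b hb] at a2
        linarith
    intro B hB B' hB' y y' hy hy' hR
    rw [key B hB y hy, key B' hB' y' hy']
    apply Finset.filter_congr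
    intro i hi
    exact forall₂_congr fun j hj => hR.le_iff hi hj

theorem cnt_cons {m : ℕ} {c v0 : ℝ} {a : ℝ × ℕ} {L L' : List (ℝ × ℕ)} (hL : Valid m c (a :: L))
    (hL' : L' = if a.2 = 1 then L else L ++ [(a.1 + 1, a.2 - 1)])
    (hv0 : c < v0) (hv0P : v0 < a.1) {S : Finset ι} {p q : Finset ι → Polynomial ℚ}
    {r : Polynomial ℚ}
    (hp : ∀ B ∈ S.powerset.erase ∅, CntS m (S \ B) v0 ((a :: L) ++ [(v0 + 1, m)]) (p B))
    (hq : ∀ B ∈ S.powerset.erase ∅, CntS m (S \ B) a.1 (L ++ [(a.1 + 1, m)]) (q B))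
    (hr : CntS m S a.1 L' r) :
    CntS m S c (a :: L) (∑ B ∈ S.powerset.erase ∅, Polynomial.X ^ 1 * p B +
      (r + ∑ B ∈ S.powerset.erase ∅, q B)) := by
  have ha := hL.2 a (by simp)
  have hamem : a.1 ∈ PL (a :: L) := ⟨a, by simp, 0, by omega, by simp⟩
  have hPa : ∀ w ∈ PL (a :: L), a.1 ≤ w := by
    rintro w ⟨b, hb, t, _, rfl⟩
    have : (0:ℝ) ≤ t := Nat.cast_nonneg t
    rcases List.mem_cons.1 hb with rfl | hb
    · linarith
    · have := hL.tail.2 b hb; linarith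
  have hF := cnt_free_union hL hv0 (fun w hw => hv0P.trans_le (hPa w hw)) hp
  have hA := Cnt.iUnion (Rel.refl m S (PL (a :: L))) (d := dval m S (PL (a :: L))) S.powerset
    (fun y => ∃ B ∈ S.powerset, YA a.1 S B y)
    (fun B => YA a.1 S B) (fun B => if B = ∅ then r else q B) ?_ (fun y => Iff.rfl) ?_
  · have hsum : (∑ B ∈ S.powerset, if B = ∅ then r else q B) =
        r + ∑ B ∈ S.powerset.erase ∅, q B := by
      rw [← Finset.add_sum_erase _ _ (Finset.empty_mem_powerset S), if_pos rfl]
      congr 1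
      exact Finset.sum_congr rfl fun B hB => if_neg (Finset.mem_erase.1 hB).1
    rw [hsum] at hA
    refine Cnt.union (Rel.refl _ _ _) (fun _ _ h => h.symm) hF hA ?_ ?_
    · intro y
      constructor
      · intro hy
        by_cases hlt : ∃ i ∈ S, y i < a.1
        · left
          obtain ⟨i, hi, hia⟩ := hlt
          obtain ⟨b, hb, hmin⟩ := S.exists_min_image y ⟨i, hi⟩
          refine ⟨S.filter (fun i => y i = y b), ?_, y b, hy b hb, ?_, ?_, ?_⟩
          · rw [Finset.mem_erase, Finset.mem_powerset]
            exact ⟨Finset.Nonempty.ne_empty ⟨b, by simp [hb]⟩, Finset.filter_subset _ _⟩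
          · intro w hw
            have := hmin i hi; have := hPa w hw; linarith
          · intro i hi
            exact (Finset.mem_filter.1 hi).2
          · intro j hj
            rw [Finset.mem_sdiff, Finset.mem_filter] at hj
            exact lt_of_le_of_ne (hmin j hj.1) (fun h => hj.2 ⟨hj.1, h.symm⟩)
        · right
          push Not at hlt
          refine ⟨S.filter (fun i => y i = a.1), by simp, ?_, ?_⟩
          · intro i hi
            exact (Finset.mem_filter.1 hi).2
          · intro j hj
            rw [Finset.mem_sdiff, Finset.mem_filter] at hj
            exact lt_of_le_of_ne (hlt j hj.1) (fun h => hj.2 ⟨hj.1, h.symm⟩)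
      · rintro (⟨B, hB, v, hv, _, h1, h2⟩ | ⟨B, hB, h1, h2⟩) i hi
        · by_cases hiB : i ∈ B
          · rwa [h1 i hiB]
          · exact hv.trans (h2 i (Finset.mem_sdiff.2 ⟨hi, hiB⟩))
        · by_cases hiB : i ∈ B
          · rw [h1 i hiB]; exact ha.1
          · exact ha.1.trans (h2 i (Finset.mem_sdiff.2 ⟨hi, hiB⟩))
    · rintro y y' ⟨B, hB, v, hv, hvP, h1, h2⟩ ⟨B', hB', h1', h2'⟩ hR
      rw [Finset.mem_erase, Finset.mem_powerset] at hB
      obtain ⟨b, hb⟩ := Finset.nonempty_iff_ne_empty.2 hB.1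
      have e := (hR.2 b (hB.2 hb) a.1 hamem).1.1 (by rw [h1 b hb]; exact hvP _ hamem)
      by_cases hbB : b ∈ B'
      · rw [h1' b hbB] at e; exact lt_irrefl _ e
      · exact lt_asymm e (h2' b (Finset.mem_sdiff.2 ⟨hB.2 hb, hbB⟩))
  · intro B hB
    split_ifs with h
    · subst h
      exact cnt_pop hL hL' hr
    · exact cnt_at hL (Finset.mem_powerset.1 hB) (Finset.nonempty_iff_ne_empty.2 h)
        (hq B (Finset.mem_erase.2 ⟨h, hB⟩))
  · have key : ∀ B ∈ S.powerset, ∀ y, YA a.1 S B y → B = S.filter (fun i => ¬ a.1 < y i) := by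
      rintro B hB y ⟨h1, h2⟩
      ext i
      rw [Finset.mem_filter]
      constructor
      · intro hi
        exact ⟨Finset.mem_powerset.1 hB hi, by rw [h1 i hi]; exact lt_irrefl _⟩
      · rintro ⟨hi, h⟩
        by_contra hiB
        exact h (h2 i (Finset.mem_sdiff.2 ⟨hi, hiB⟩))
    intro B hB B' hB' y y' hy hy' hR
    rw [key B hB y hy, key B' hB' y' hy']
    apply Finset.filter_congr
    intro i hi
    rw [(hR.2 i hi a.1 hamem).2]

theorem cnt_nil {m : ℕ} {c v0 : ℝ} (hv0 : c < v0) {S : Finset ι} {p : Finset ι → Polynomial ℚ}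
    (hp : ∀ B ∈ S.powerset.erase ∅, CntS m (S \ B) v0 [(v0 + 1, m)] (p B)) :
    CntS m S c [] ((if S = ∅ then 1 else 0) +
      ∑ B ∈ S.powerset.erase ∅, Polynomial.X ^ 1 * p B) := by
  by_cases hS : S = ∅
  · subst hS
    refine ⟨{0}, ?_, ?_, ?_, ?_⟩
    · intro t _ i hi; simp at hi
    · intro y _
      exact ⟨0, by simp, ⟨fun i hi => by simp at hi, fun i hi => by simp at hi⟩⟩
    · intro t ht t' ht' _
      rw [Finset.mem_singleton.1 ht, Finset.mem_singleton.1 ht']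
    · simp [dval]
  · have hP : ∀ w : ℝ, w ∉ PL [] := by
      rintro w ⟨a, ha, _⟩; simp at ha
    have hF := cnt_free_union (m := m) (c := c) (v0 := v0) (L := []) ⟨by simp, by simp⟩ hv0
      (fun w hw => absurd hw (hP w)) hp
    rw [if_neg hS, zero_add]
    convert hF using 1
    funext y
    apply propext
    constructor
    · intro hy
      obtain ⟨b, hb, hmin⟩ := S.exists_min_image y (Finset.nonempty_iff_ne_empty.2 hS)
      refine ⟨S.filter (fun i => y i = y b), ?_, y b, hy b hb, ?_, ?_, ?_⟩
      · rw [Finset.mem_erase, Finset.mem_powerset]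
        exact ⟨Finset.Nonempty.ne_empty ⟨b, by simp [hb]⟩, Finset.filter_subset _ _⟩
      · intro w hw; exact absurd hw (hP w)
      · intro i hi
        exact (Finset.mem_filter.1 hi).2
      · intro j hj
        rw [Finset.mem_sdiff, Finset.mem_filter] at hj
        exact lt_of_le_of_ne (hmin j hj.1) (fun h => hj.2 ⟨hj.1, h.symm⟩)
    · rintro ⟨B, hB, v, hv, _, h1, h2⟩ i hi
      by_cases hiB : i ∈ B
      · rwa [h1 i hiB]
      · exact hv.trans (h2 i (Finset.mem_sdiff.2 ⟨hi, hiB⟩))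

end Steps

/-! ### Generating functions -/

section Series
open PowerSeries

theorem eexp_eq : Eexp = PowerSeries.exp (Polynomial ℚ) := by
  ext n
  simp [Eexp, PowerSeries.coeff_exp, Polynomial.algebraMap_eq]

theorem eexpNeg_eq : EexpNeg = PowerSeries.evalNegHom (PowerSeries.exp (Polynomial ℚ)) := by
  ext n
  simp [EexpNeg, PowerSeries.evalNegHom, PowerSeries.coeff_rescale, PowerSeries.coeff_exp,
    Polynomial.algebraMap_eq]

theorem eexp_mul_neg : Eexp * EexpNeg = 1 := by
  rw [eexp_eq, eexpNeg_eq, PowerSeries.exp_mul_exp_neg_eq_one]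

theorem X_dvd_one_sub : (PowerSeries.X : PowerSeries (Polynomial ℚ)) ∣ 1 - EexpNeg := by
  rw [PowerSeries.X_dvd_iff, ← PowerSeries.coeff_zero_eq_constantCoeff_apply, map_sub, EexpNeg,
    PowerSeries.coeff_mk, PowerSeries.coeff_one]
  simp

noncomputable def Phi (m : ℕ) (G : PowerSeries (Polynomial ℚ)) : PowerSeries (Polynomial ℚ) :=
  EexpNeg + (1 + Useries) * (1 - EexpNeg) * G ^ (m + 1)

theorem phi_contract (m k : ℕ) (G H : PowerSeries (Polynomial ℚ))
    (h : PowerSeries.X ^ k ∣ G - H) : PowerSeries.X ^ (k + 1) ∣ Phi m G - Phi m H := by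
  have e : Phi m G - Phi m H =
      (1 + Useries) * ((1 - EexpNeg) * (G ^ (m + 1) - H ^ (m + 1))) := by
    unfold Phi; ring
  rw [e, pow_succ']
  exact Dvd.dvd.mul_left (mul_dvd_mul X_dvd_one_sub (h.trans (sub_dvd_pow_sub_pow _ _ _))) _

theorem eq_of_X_pow_dvd (G H : PowerSeries (Polynomial ℚ))
    (h : ∀ k, (PowerSeries.X : PowerSeries (Polynomial ℚ)) ^ k ∣ G - H) : G = H := by
  ext1 n
  have := (PowerSeries.X_pow_dvd_iff.1 (h (n + 1))) n (by omega)
  rwa [map_sub, sub_eq_zero] at this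

theorem phi_unique (m : ℕ) (G H : PowerSeries (Polynomial ℚ)) (hG : G = Phi m G)
    (hH : H = Phi m H) : G = H := by
  apply eq_of_X_pow_dvd
  intro k
  induction k with
  | zero => simp
  | succ k ih =>
    rw [hG, hH]
    exact phi_contract m k G H ih

theorem phi_exists (m : ℕ) : ∃ G, G = Phi m G := by
  set a : ℕ → PowerSeries (Polynomial ℚ) := fun k => (Phi m)^[k] 0 with ha
  have hs : ∀ k, a (k + 1) = Phi m (a k) := fun k => Function.iterate_succ_apply' _ _ _
  have h1 : ∀ k, PowerSeries.X ^ k ∣ a (k + 1) - a k := by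
    intro k
    induction k with
    | zero => simp
    | succ k ih =>
      have := phi_contract m k _ _ ih
      rwa [← hs, ← hs] at this
  have h2 : ∀ k j, PowerSeries.X ^ k ∣ a (k + j) - a k := by
    intro k j
    induction j with
    | zero => simp
    | succ j ih =>
      have := dvd_add ((pow_dvd_pow _ (by omega)).trans (h1 (k + j))) ih
      rwa [sub_add_sub_cancel] at this
  set G : PowerSeries (Polynomial ℚ) := PowerSeries.mk fun n => coeff n (a (n + 1)) with hG
  have h3 : ∀ k, PowerSeries.X ^ k ∣ G - a k := by
    intro k
    rw [PowerSeries.X_pow_dvd_iff]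
    intro n hn
    obtain ⟨j, rfl⟩ := Nat.exists_eq_add_of_lt hn
    have := (PowerSeries.X_pow_dvd_iff.1 (h2 (n + 1) j)) n (by omega)
    rw [map_sub, sub_eq_zero] at this
    rw [map_sub, hG, PowerSeries.coeff_mk, ← this, sub_eq_zero]
    congr 2; omega
  refine ⟨G, ?_⟩
  apply eq_of_X_pow_dvd
  intro k
  have e1 := h3 (k + 1)
  have e2 := phi_contract m k _ _ (h3 k)
  rw [← hs] at e2
  have := dvd_sub e1 e2
  rw [sub_sub_sub_cancel_right] at this
  exact (pow_dvd_pow _ (by omega)).trans this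

/-- `n!` times the `n`-th coefficient. -/
noncomputable def fc (n : ℕ) (H : PowerSeries (Polynomial ℚ)) : Polynomial ℚ :=
  Polynomial.C (n.factorial : ℚ) * coeff n H

theorem fc_add (n : ℕ) (H K : PowerSeries (Polynomial ℚ)) : fc n (H + K) = fc n H + fc n K := by
  simp [fc, mul_add]

theorem fc_exp_mul {ι : Type*} (S : Finset ι) (H : PowerSeries (Polynomial ℚ)) :
    fc S.card (Eexp * H) = ∑ B ∈ S.powerset, fc (S \ B).card H := by
  have h1 : ∑ B ∈ S.powerset, fc (S \ B).card H =
      ∑ B ∈ S.powerset, (fun k => fc (S.card - k) H) B.card := by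
    refine Finset.sum_congr rfl fun B hB => ?_
    rw [Finset.card_sdiff_of_subset (Finset.mem_powerset.1 hB)]
  rw [h1, Finset.sum_powerset_apply_card (fun k => fc (S.card - k) H), fc, PowerSeries.coeff_mul,
    Finset.Nat.sum_antidiagonal_eq_sum_range_succ_mk, Finset.mul_sum]
  refine Finset.sum_congr rfl fun k hk => ?_
  have hk : k ≤ S.card := by simpa [Nat.lt_succ_iff] using hk
  rw [fc, nsmul_eq_mul, ← mul_assoc, ← mul_assoc, Eexp, PowerSeries.coeff_mk, ← Polynomial.C_mul,
    ← Polynomial.C_eq_natCast, ← Polynomial.C_mul]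
  congr 2
  have h := Nat.choose_mul_factorial_mul_factorial hk
  have hk0 : (k.factorial : ℚ) ≠ 0 := by exact_mod_cast k.factorial_ne_zero
  rw [← h]
  push_cast
  field_simp

theorem fc_E_mul {ι : Type*} (S : Finset ι) (H : PowerSeries (Polynomial ℚ)) :
    fc S.card ((Eexp - 1) * H) = ∑ B ∈ S.powerset.erase ∅, fc (S \ B).card H := by
  have h1 := fc_exp_mul S H
  rw [← Finset.add_sum_erase _ _ (Finset.empty_mem_powerset S), Finset.sdiff_empty] at h1
  have h2 : fc S.card (Eexp * H) = fc S.card ((Eexp - 1) * H) + fc S.card H := by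
    rw [← fc_add]; congr 1; ring
  rw [h2, add_comm] at h1
  exact add_left_cancel h1

theorem fc_U_mul (n : ℕ) (H : PowerSeries (Polynomial ℚ)) :
    fc n (Useries * H) = Polynomial.X * fc n H := by
  rw [fc, Useries, PowerSeries.coeff_C_mul, fc]; ring

noncomputable def wt (G : PowerSeries (Polynomial ℚ)) (l : ℕ) : PowerSeries (Polynomial ℚ) :=
  (1 + Useries) * G ^ l - 1

noncomputable def FL (G : PowerSeries (Polynomial ℚ)) (L : List (ℝ × ℕ)) :
    PowerSeries (Polynomial ℚ) := G * (L.map fun a => wt G a.2).prod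

theorem FL_append (G : PowerSeries (Polynomial ℚ)) (L L' : List (ℝ × ℕ)) :
    FL G (L ++ L') = FL G L * (L'.map fun a => wt G a.2).prod := by
  simp [FL, mul_assoc]

theorem FL_cons (G : PowerSeries (Polynomial ℚ)) (a : ℝ × ℕ) (L : List (ℝ × ℕ)) :
    FL G (a :: L) = FL G L * wt G a.2 := by
  simp [FL]; ring

theorem G_eq {m : ℕ} {G : PowerSeries (Polynomial ℚ)} (hG : G = Phi m G) :
    G = 1 + (Eexp - 1) * (G * wt G m) := by
  have h : Eexp * G = Eexp * Phi m G := by rw [← hG]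
  unfold Phi at h
  unfold wt
  linear_combination h + (1 - (1 + Useries) * G ^ (m + 1)) * eexp_mul_neg

theorem wt_rec {m : ℕ} {G : PowerSeries (Polynomial ℚ)} (hG : G = Phi m G) (l : ℕ) :
    wt G (l + 1) = (Eexp - 1) * (wt G (l + 1) * wt G m) + wt G l + (Eexp - 1) * wt G m := by
  have h := G_eq hG
  have e1 : wt G (l + 1) = (1 + Useries) * G ^ l * G - 1 := by unfold wt; ring
  have e2 : wt G l = (1 + Useries) * G ^ l - 1 := rfl
  rw [e1, e2]
  linear_combination (1 + Useries) * G ^ l * h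

theorem wt_zero (G : PowerSeries (Polynomial ℚ)) : wt G 0 = Useries := by
  simp [wt]

theorem fc_one (n : ℕ) : fc n 1 = if n = 0 then 1 else 0 := by
  rw [fc, PowerSeries.coeff_one]
  split_ifs with h
  · subst h; simp
  · simp

theorem main_count {ι : Type*} {m : ℕ} (hm : 0 < m) {G : PowerSeries (Polynomial ℚ)}
    (hG : G = Phi m G) : ∀ (n N : ℕ) (S : Finset ι) (c : ℝ) (L : List (ℝ × ℕ)),
    S.card = n → (L.map Prod.snd).sum = N → Valid m c L →
    ∃ p, CntS m S c L p ∧ Polynomial.X ^ L.length * p = fc S.card (FL G L) := by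
  intro n
  induction n using Nat.strong_induction_on with
  | _ n ihn =>
  intro N
  induction N using Nat.strong_induction_on with
  | _ N ihN =>
  intro S c L hS hN hL
  have hlt : ∀ B ∈ S.powerset.erase ∅, (S \ B).card < n := by
    intro B hB
    rw [Finset.mem_erase, Finset.mem_powerset] at hB
    have := Finset.card_pos.2 (Finset.nonempty_iff_ne_empty.2 hB.1)
    have := Finset.card_le_card hB.2
    rw [Finset.card_sdiff_of_subset hB.2]; omega
  have IH : ∀ B ∈ S.powerset.erase ∅, ∀ c' L', Valid m c' L' →
      ∃ p, CntS m (S \ B) c' L' p ∧ Polynomial.X ^ L'.length * p = fc (S \ B).card (FL G L') :=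
    fun B hB c' L' h => ihn _ (hlt B hB) _ (S \ B) c' L' rfl rfl h
  cases L with
  | nil =>
    have hv : Valid m (c + 1) [(c + 1 + 1, m)] := by
      simp [Valid]; omega
    choose! p hp1 hp2 using fun B hB => IH B hB (c + 1) _ hv
    refine ⟨_, cnt_nil (v0 := c + 1) (by linarith) hp1, ?_⟩
    have e : FL G [] = 1 + (Eexp - 1) * FL G [(c + 1 + 1, m)] := by
      have := G_eq hG
      simpa [FL] using this
    rw [e, fc_add, fc_E_mul, fc_one, List.length_nil, pow_zero, one_mul]
    congr 1
    · simp [Finset.card_eq_zero]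
    · refine Finset.sum_congr rfl fun B hB => ?_
      rw [← hp2 B hB]; simp
  | cons a L =>
    have ha := hL.2 a (by simp)
    obtain ⟨hLt, hLa⟩ := hL.tail
    obtain ⟨v0, hv0, hv0'⟩ := exists_between ha.1
    have hLv : ∀ b ∈ a :: L, v0 < b.1 := by
      intro b hb
      rcases List.mem_cons.1 hb with rfl | hb
      · exact hv0'
      · exact hv0'.trans (hLa b hb)
    choose! p hp1 hp2 using fun B hB => IH B hB v0 _
      (Valid.snoc (l := m) (p := v0 + 1) hv0 hL hLv hm le_rfl rfl)
    choose! q hq1 hq2 using fun B hB => IH B hB a.1 _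
      (Valid.snoc (l := m) (p := a.1 + 1) ha.1 hLt hLa hm le_rfl rfl)
    obtain ⟨L', hL'⟩ : ∃ L', L' = if a.2 = 1 then L else L ++ [(a.1 + 1, a.2 - 1)] := ⟨_, rfl⟩
    obtain ⟨l, hl⟩ : ∃ l, a.2 = l + 1 := ⟨a.2 - 1, by omega⟩
    have hL'v : Valid m a.1 L' := by
      rw [hL']
      split_ifs with h
      · exact hLt.mono ha.1.le hLa
      · exact Valid.snoc ha.1 hLt hLa (by omega) (by omega) rfl
    have hL's : (L'.map Prod.snd).sum < N := by
      rw [← hN, hL']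
      split_ifs with h
      · simp [h]
      · simp [hl]; omega
    obtain ⟨r, hr1, hr2⟩ := ihN _ hL's S a.1 L' hS rfl hL'v
    have hr3 : Polynomial.X ^ (L.length + 1) * r = fc S.card (FL G L * wt G l) := by
      rw [hL'] at hr2
      split_ifs at hr2 with h
      · obtain rfl : l = 0 := by omega
        rw [wt_zero, mul_comm (FL G L), fc_U_mul, ← hr2]; ring
      · rw [FL_append] at hr2
        simpa [hl] using hr2
    refine ⟨_, cnt_cons hL hL' hv0 hv0' hp1 hq1 hr1, ?_⟩
    have e : FL G (a :: L) = (Eexp - 1) * FL G ((a :: L) ++ [(v0 + 1, m)]) +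
        (FL G L * wt G l + (Eexp - 1) * FL G (L ++ [(a.1 + 1, m)])) := by
      have := wt_rec hG l
      rw [FL_append, FL_append, FL_cons, hl]
      simp only [List.map_cons, List.map_nil, List.prod_cons, List.prod_nil, mul_one]
      linear_combination FL G L * this
    rw [e, fc_add, fc_add, fc_E_mul, fc_E_mul, List.length_cons, mul_add, mul_add, hr3,
      Finset.mul_sum, Finset.mul_sum]
    congr 1
    · refine Finset.sum_congr rfl fun B hB => ?_
      rw [← hp2 B hB]; simp; ring
    · congr 1
      refine Finset.sum_congr rfl fun B hB => ?_
      rw [← hq2 B hB]; simp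

end Series

/-! ### Faces -/

section Faces

theorem hyp_eq {n : ℕ} {i j i' j' : Fin n} {s s' : ℝ} (hij : i ≠ j)
    (h : hyp n i j s = hyp n i' j' s') :
    (i' = i ∧ j' = j ∧ s' = s) ∨ (i' = j ∧ j' = i ∧ s' = -s) := by
  have key : ∀ y : Fin n → ℝ, y i - y j = s ↔ y i' - y j' = s' := fun y => by
    have : y ∈ hyp n i j s ↔ y ∈ hyp n i' j' s' := by rw [h]
    exact this
  set y0 : Fin n → ℝ := fun k => if k = i then s else 0 with hy0
  have hy0i : y0 i = s := by simp [hy0]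
  have hy0j : y0 j = 0 := by simp [hy0, hij.symm]
  have b0 : y0 i' - y0 j' = s' := (key y0).1 (by rw [hy0i, hy0j]; ring)
  have hne : i' ≠ j' := by
    rintro rfl
    have := (key (Function.update y0 i (s + 1))).2 (by simpa using b0)
    simp [Function.update_of_ne hij.symm, hy0j] at this
  have hi' : i' = i ∨ i' = j := by
    by_contra hcon
    push Not at hcon
    have := (key (Function.update y0 i' (y0 i' + 1))).1 (by
      rw [Function.update_of_ne hcon.1.symm, Function.update_of_ne hcon.2.symm, hy0i, hy0j]; ring)
    rw [Function.update_self, Function.update_of_ne hne.symm] at this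
    linarith
  have hj' : j' = i ∨ j' = j := by
    by_contra hcon
    push Not at hcon
    have := (key (Function.update y0 j' (y0 j' + 1))).1 (by
      rw [Function.update_of_ne hcon.1.symm, Function.update_of_ne hcon.2.symm, hy0i, hy0j]; ring)
    rw [Function.update_self, Function.update_of_ne hne] at this
    linarith
  rcases hi' with rfl | rfl <;> rcases hj' with rfl | rfl
  · exact absurd rfl hne
  · left; refine ⟨rfl, rfl, ?_⟩; linarith
  · right; refine ⟨rfl, rfl, ?_⟩; linarith
  · exact absurd rfl hne

theorem side_iff {n : ℕ} {i j : Fin n} {s : ℝ} (hij : i ≠ j) {σ : Set (Fin n → ℝ)}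
    (h : IsSideOf n σ (hyp n i j s)) {x : Fin n → ℝ} (hx : x ∈ σ) (y : Fin n → ℝ) :
    y ∈ σ ↔ ((x i - x j < s ↔ y i - y j < s) ∧ (s < x i - x j ↔ s < y i - y j)) := by
  have main : (σ = {x | x i - x j = s}) ∨ (σ = {x | x i - x j < s}) ∨ (σ = {x | s < x i - x j}) := by
    rcases h with h | ⟨i', j', s', h1, h2⟩
    · exact Or.inl h
    · rcases hyp_eq hij h1 with ⟨rfl, rfl, rfl⟩ | ⟨rfl, rfl, rfl⟩
      · exact Or.inr h2
      · right
        rcases h2 with h2 | h2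
        · right; rw [h2]; ext z; constructor <;> intro hz
          · have hz : z i' - z j' < -s := hz
            show s < z j' - z i'
            linarith
          · have hz : s < z j' - z i' := hz
            show z i' - z j' < -s
            linarith
        · left; rw [h2]; ext z; constructor <;> intro hz
          · have hz : -s < z i' - z j' := hz
            show z j' - z i' < s
            linarith
          · have hz : z j' - z i' < s := hz
            show -s < z i' - z j'
            linarith
  rcases main with rfl | rfl | rfl
  · have hx : x i - x j = s := hx
    show y i - y j = s ↔ _
    rw [hx]
    simp only [lt_irrefl, false_iff, not_lt]
    constructor
    · rintro h; simp [h]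
    · rintro ⟨h1, h2⟩; exact le_antisymm h2 h1
  · have hx : x i - x j < s := hx
    show y i - y j < s ↔ _
    simp only [hx, hx.not_gt, true_iff, false_iff, not_lt]
    exact ⟨fun h => ⟨h, h.le⟩, fun h => h.1⟩
  · have hx : s < x i - x j := hx
    show s < y i - y j ↔ _
    simp only [hx, hx.not_gt, true_iff, false_iff, not_lt]
    exact ⟨fun h => ⟨h.le, h⟩, fun h => h.2⟩

theorem rel_univ_iff {m n : ℕ} (x y : Fin n → ℝ) : Rel m Finset.univ ∅ x y ↔
    ∀ i j : Fin n, i < j → ∀ s : ℤ, s.natAbs ≤ m →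
      ((x i - x j < s ↔ y i - y j < s) ∧ ((s : ℝ) < x i - x j ↔ (s : ℝ) < y i - y j)) := by
  constructor
  · intro h i j _ s hs
    have h1 := h.1 i (Finset.mem_univ _) j (Finset.mem_univ _) s hs
    have h2 := h.1 j (Finset.mem_univ _) i (Finset.mem_univ _) (-s) (by simpa using hs)
    rw [sub_lt_iff_lt_add', sub_lt_iff_lt_add', lt_sub_iff_add_lt', lt_sub_iff_add_lt']
    push_cast at h2
    refine ⟨h1, ?_⟩
    rw [← lt_sub_iff_add_lt, ← lt_sub_iff_add_lt, sub_eq_add_neg, sub_eq_add_neg]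
    exact h2
  · intro h
    refine ⟨fun i _ j _ s hs => ?_, fun i _ p hp => absurd hp (Set.notMem_empty p)⟩
    rcases lt_trichotomy i j with hij | rfl | hij
    · have := (h i j hij s hs).1
      rwa [sub_lt_iff_lt_add', sub_lt_iff_lt_add'] at this
    · simp
    · have := (h j i hij (-s) (by simpa using hs)).2
      push_cast at this
      constructor
      · intro h; have := this.1 (by linarith); linarith
      · intro h; have := this.2 (by linarith); linarith

theorem inter_eq {m n : ℕ} {σ : Set (Fin n → ℝ) → Set (Fin n → ℝ)}
    (hσ : ∀ H ∈ arrS {s : ℤ | s.natAbs ≤ m} n, IsSideOf n (σ H) H) {x : Fin n → ℝ}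
    (hx : ∀ H ∈ arrS {s : ℤ | s.natAbs ≤ m} n, x ∈ σ H) :
    (⋂ H ∈ arrS {s : ℤ | s.natAbs ≤ m} n, σ H) = {y | Rel m Finset.univ ∅ x y} := by
  ext y
  rw [Set.mem_iInter₂]
  show _ ↔ Rel m Finset.univ ∅ x y
  rw [rel_univ_iff]
  constructor
  · intro h i j hij s hs
    have hH : hyp n i j (s : ℝ) ∈ arrS {s : ℤ | s.natAbs ≤ m} n := ⟨i, j, s, hij, hs, rfl⟩
    exact (side_iff hij.ne (hσ _ hH) (hx _ hH) y).1 (h _ hH)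
  · rintro h H hH
    have hH' := hH
    obtain ⟨i, j, s, hij, hs, rfl⟩ := hH'
    exact (side_iff hij.ne (hσ _ hH) (hx _ hH) y).2 (h i j hij s hs)

theorem isFace_iff {m n : ℕ} (F : Set (Fin n → ℝ)) :
    IsFace n (arrS {s : ℤ | s.natAbs ≤ m} n) F ↔ ∃ x, F = {y | Rel m Finset.univ ∅ x y} := by
  constructor
  · rintro ⟨⟨x, hx⟩, σ, hσ, rfl⟩
    exact ⟨x, inter_eq hσ (Set.mem_iInter₂.1 hx)⟩
  · rintro ⟨x, rfl⟩
    refine ⟨⟨x, Rel.refl _ _ _ x⟩, ?_⟩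
    have : ∀ H ∈ arrS {s : ℤ | s.natAbs ≤ m} n, ∃ σ, IsSideOf n σ H ∧ x ∈ σ := by
      rintro H ⟨i, j, s, hij, hs, rfl⟩
      rcases lt_trichotomy (x i - x j) (s : ℝ) with h | h | h
      · exact ⟨_, Or.inr ⟨i, j, s, rfl, Or.inl rfl⟩, h⟩
      · exact ⟨_, Or.inl rfl, h⟩
      · exact ⟨_, Or.inr ⟨i, j, s, rfl, Or.inr rfl⟩, h⟩
    choose! σ h1 h2 using this
    exact ⟨σ, h1, (inter_eq h1 h2).symm⟩

/-- The direction of the face of `x`. -/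
def DirSub (m : ℕ) {n : ℕ} (x : Fin n → ℝ) : Submodule ℝ (Fin n → ℝ) where
  carrier := {w | ∀ i j, ∀ s : ℤ, s.natAbs ≤ m → x i = x j + s → w i = w j}
  add_mem' := by
    intro a b ha hb i j s hs h
    simp [ha i j s hs h, hb i j s hs h]
  zero_mem' := by intro i j s hs h; rfl
  smul_mem' := by
    intro c a ha i j s hs h
    simp [ha i j s hs h]

theorem mem_dirSub {m n : ℕ} {x w : Fin n → ℝ} : w ∈ DirSub m x ↔
    ∀ i j, ∀ s : ℤ, s.natAbs ≤ m → x i = x j + s → w i = w j := Iff.rfl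

theorem Rel.eq_of {m n : ℕ} {x y : Fin n → ℝ} (h : Rel m Finset.univ ∅ x y) {i j : Fin n} {s : ℤ}
    (hs : s.natAbs ≤ m) (hx : x i = x j + s) : y i = y j + s := by
  have h1 := h.1 i (Finset.mem_univ _) j (Finset.mem_univ _) s hs
  have h2 := h.1 j (Finset.mem_univ _) i (Finset.mem_univ _) (-s) (by simpa using hs)
  push_cast at h2
  have a1 : ¬ y i < y j + s := fun h => by have := h1.2 h; linarith
  have a2 : ¬ y j < y i + -s := fun h => by have := h2.2 h; linarith
  linarith

theorem exists_eps {m n : ℕ} {x w : Fin n → ℝ} (hw : w ∈ DirSub m x) :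
    ∃ ε : ℝ, 0 < ε ∧ Rel m Finset.univ ∅ x (x + ε • w) := by
  have hev : ∀ᶠ ε : ℝ in nhdsWithin 0 (Set.Ioi 0), ∀ i j : Fin n, ∀ s ∈ Finset.Icc (-(m : ℤ)) m,
      (x i < x j + s ↔ x i + ε * w i < x j + ε * w j + s) := by
    refine Filter.eventually_all.2 fun i => Filter.eventually_all.2 fun j =>
      (Filter.eventually_all_finset _).2 fun s hs => ?_
    rw [Finset.mem_Icc] at hs
    apply Filter.Eventually.filter_mono nhdsWithin_le_nhds
    have c1 : ContinuousAt (fun ε : ℝ => x i + ε * w i) 0 := by fun_prop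
    have c2 : ContinuousAt (fun ε : ℝ => x j + ε * w j + s) 0 := by fun_prop
    rcases lt_trichotomy (x i) (x j + s) with h | h | h
    · filter_upwards [c1.eventually_lt c2 (by simpa using h)] with ε hε
      exact ⟨fun _ => hε, fun _ => h⟩
    · refine Filter.Eventually.of_forall fun ε => ?_
      have := hw i j s (by omega) h
      rw [this, h]
      constructor <;> intro h' <;> linarith
    · filter_upwards [c2.eventually_lt c1 (by simpa using h)] with ε hε
      exact ⟨fun h' => absurd h' h.not_gt, fun h' => absurd h' hε.not_gt⟩
  obtain ⟨ε, h1, h2⟩ := (hev.and self_mem_nhdsWithin).exists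
  refine ⟨ε, h2, fun i _ j _ s hs => ?_, fun i _ p hp => absurd hp (Set.notMem_empty p)⟩
  exact h1 i j s (by rw [Finset.mem_Icc]; omega)

theorem direction_eq {m n : ℕ} (x : Fin n → ℝ) :
    (affineSpan ℝ {y | Rel m Finset.univ ∅ x y}).direction = DirSub m x := by
  rw [direction_affineSpan]
  apply le_antisymm
  · rw [vectorSpan_def, Submodule.span_le]
    rintro _ ⟨y, hy, z, hz, rfl⟩ i j s hs h
    have h1 := Rel.eq_of hy hs h
    have h2 := Rel.eq_of hz hs h
    simp only [vsub_eq_sub, Pi.sub_apply]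
    linarith
  · intro w hw
    obtain ⟨ε, hε, h⟩ := exists_eps hw
    have h1 : (x + ε • w) -ᵥ x ∈ vectorSpan ℝ {y | Rel m Finset.univ ∅ x y} :=
      vsub_mem_vectorSpan ℝ h (Rel.refl _ _ _ x)
    have h2 : (x + ε • w) -ᵥ x = ε • w := by simp
    rw [h2] at h1
    exact (Submodule.smul_mem_iff _ hε.ne').1 h1

noncomputable def rk {n : ℕ} (x : Fin n → ℝ) (i : Fin n) : ℕ :=
  (Finset.univ.filter fun j => x j < x i).card

theorem rk_lt {n : ℕ} {x : Fin n → ℝ} {i j : Fin n} (h : x j < x i) : rk x j < rk x i := by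
  apply Finset.card_lt_card
  rw [Finset.ssubset_iff_of_subset]
  · exact ⟨j, by simp [h], by simp⟩
  · intro k hk
    simp only [Finset.mem_filter, Finset.mem_univ, true_and] at hk ⊢
    exact hk.trans h

def Par (m : ℕ) {n : ℕ} (x : Fin n → ℝ) (i j : Fin n) : Prop :=
  ∃ s : ℕ, 1 ≤ s ∧ s ≤ m ∧ x i = x j + s

def MPar (m : ℕ) {n : ℕ} (x : Fin n → ℝ) (i j : Fin n) : Prop :=
  Par m x i j ∧ ∀ k, Par m x i k → x k ≤ x j

theorem Par.lt {m n : ℕ} {x : Fin n → ℝ} {i j : Fin n} (h : Par m x i j) : x j < x i := by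
  obtain ⟨s, h1, _, h⟩ := h
  have : (1:ℝ) ≤ s := by exact_mod_cast h1
  linarith

noncomputable def hfun (m : ℕ) {n : ℕ} (x : Fin n → ℝ) (g : ℝ → ℝ) (i : Fin n) : ℝ :=
  if h : ∃ j, MPar m x i j then hfun m x g h.choose else g (x i)
termination_by rk x i
decreasing_by exact rk_lt h.choose_spec.1.lt

theorem hfun_root {m n : ℕ} {x : Fin n → ℝ} {g : ℝ → ℝ} {i : Fin n} (h : ∀ j, ¬ Par m x i j) :
    hfun m x g i = g (x i) := by
  rw [hfun, dif_neg]
  rintro ⟨j, hj⟩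
  exact h j hj.1

theorem hfun_par {m n : ℕ} {x : Fin n → ℝ} {g : ℝ → ℝ} {i : Fin n} (h : ∃ j, Par m x i j) :
    ∃ j, MPar m x i j ∧ hfun m x g i = hfun m x g j := by
  have h' : ∃ j, MPar m x i j := by
    obtain ⟨j, hj⟩ := h
    obtain ⟨b, hb, hmax⟩ := (Finset.univ.filter (Par m x i)).exists_max_image x ⟨j, by simpa using hj⟩
    exact ⟨b, by simpa using hb, fun k hk => hmax k (by simpa using hk)⟩
  refine ⟨h'.choose, h'.choose_spec, ?_⟩
  conv_lhs => rw [hfun, dif_pos h']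

theorem hfun_link {m n : ℕ} {x : Fin n → ℝ} {g : ℝ → ℝ} : ∀ (N : ℕ) (i k : Fin n), rk x i = N →
    ∀ s : ℕ, s ≤ m → x i = x k + s → hfun m x g i = hfun m x g k := by
  intro N
  induction N using Nat.strong_induction_on with
  | _ N ih =>
  intro i k hN s hs h
  by_cases hp : ∃ j, Par m x i j
  · obtain ⟨j, hj, e⟩ := hfun_par (g := g) hp
    have hlt : rk x j < N := hN ▸ rk_lt hj.1.lt
    rw [e]
    rcases Nat.eq_zero_or_pos s with rfl | hs0
    · have hxx : x i = x k := by simpa using h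
      have hp' : ∃ j, Par m x k j := by
        obtain ⟨j, s, h1, h2, h3⟩ := hp
        exact ⟨j, s, h1, h2, hxx ▸ h3⟩
      obtain ⟨j', hj', e'⟩ := hfun_par (g := g) hp'
      rw [e']
      refine ih _ hlt j j' rfl 0 (by omega) ?_
      have a1 : x j ≤ x j' := hj'.2 j (by unfold Par; rw [← hxx]; exact hj.1)
      have a2 : x j' ≤ x j := hj.2 j' (by unfold Par; rw [hxx]; exact hj'.1)
      simp; linarith
    · have hle : x k ≤ x j := hj.2 k ⟨s, hs0, hs, h⟩
      obtain ⟨t, ht1, ht2, ht⟩ := hj.1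
      have hts : t ≤ s := by
        have : (t : ℝ) ≤ s := by linarith
        exact_mod_cast this
      refine ih _ hlt j k rfl (s - t) (by omega) ?_
      rw [Nat.cast_sub hts]; linarith
  · push Not at hp
    rcases Nat.eq_zero_or_pos s with rfl | hs0
    · have hxx : x i = x k := by simpa using h
      rw [hfun_root hp, hfun_root (i := k), hxx]
      intro j hj
      apply hp j
      unfold Par; rw [hxx]; exact hj
    · exact absurd ⟨s, hs0, hs, h⟩ (hp k)

theorem finrank_dirSub {m n : ℕ} (x : Fin n → ℝ) :
    Module.finrank ℝ (DirSub m x) = dval m Finset.univ ∅ x := by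
  obtain ⟨V, hV, hVc⟩ : ∃ V : Finset ℝ, (∀ v, v ∈ V ↔ (∃ i, x i = v) ∧
      ∀ j, ∀ s : ℕ, 1 ≤ s → s ≤ m → v ≠ x j + s) ∧ V.card = dval m Finset.univ ∅ x := by
    refine ⟨_, ?_, rfl⟩
    intro v
    simp
  have hVmem : ∀ i, x i ∈ V ↔ ∀ j, ¬ Par m x i j := by
    intro i
    rw [hV]
    constructor
    · rintro ⟨_, h⟩ j ⟨s, h1, h2, h3⟩
      exact h j s h1 h2 h3
    · intro h
      exact ⟨⟨i, rfl⟩, fun j s h1 h2 h3 => h j ⟨s, h1, h2, h3⟩⟩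
  have hidx : ∀ v : V, ∃ i, x i = v := fun v => ((hV v.1).1 v.2).1
  choose idx hidx using hidx
  let f : DirSub m x →ₗ[ℝ] (V → ℝ) :=
    { toFun := fun w v => w.1 (idx v)
      map_add' := fun _ _ => rfl
      map_smul' := fun _ _ => rfl }
  have hinj : Function.Injective f := by
    rw [injective_iff_map_eq_zero]
    rintro ⟨w, hw⟩ h0
    have h0' : ∀ v, w (idx v) = 0 := fun v => congrFun h0 v
    have : ∀ (N : ℕ) i, rk x i = N → w i = 0 := by
      intro N
      induction N using Nat.strong_induction_on with
      | _ N ih =>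
      intro i hi
      by_cases hp : x i ∈ V
      · rw [← h0' ⟨x i, hp⟩]
        exact hw i _ 0 (by simp) (by simp [hidx])
      · rw [hVmem] at hp
        push Not at hp
        obtain ⟨j, hj⟩ := hp
        rw [← ih _ (hi ▸ rk_lt hj.lt) j rfl]
        obtain ⟨s, h1, h2, h3⟩ := hj
        exact hw i j s (by simpa using h2) (by simpa using h3)
    apply Subtype.ext
    funext i
    exact this _ i rfl
  have hsurj : Function.Surjective f := by
    intro g
    let g' : ℝ → ℝ := fun v => if h : v ∈ V then g ⟨v, h⟩ else 0
    refine ⟨⟨hfun m x g', ?_⟩, ?_⟩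
    · intro i j s hs h
      rcases le_total 0 s with h0 | h0
      · obtain ⟨k, rfl⟩ := Int.eq_ofNat_of_zero_le h0
        exact hfun_link _ i j rfl k (by simpa using hs) (by simpa using h)
      · obtain ⟨k, hk⟩ := Int.eq_ofNat_of_zero_le (a := -s) (by omega)
        obtain rfl : s = -k := by omega
        refine (hfun_link _ j i rfl k (by simpa using hs) ?_).symm
        push_cast at h; linarith
    · funext v
      show hfun m x g' (idx v) = g v
      have hv : x (idx v) ∈ V := by rw [hidx]; exact v.2
      rw [hfun_root ((hVmem _).1 hv), hidx]
      simp [g']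
  rw [(LinearEquiv.ofBijective f ⟨hinj, hsurj⟩).finrank_eq, ← hVc]
  simp

theorem faceDim_eq {m n : ℕ} (x : Fin n → ℝ) :
    faceDim n {y | Rel m Finset.univ ∅ x y} = dval m Finset.univ ∅ x := by
  rw [faceDim, direction_eq, finrank_dirSub]

theorem PL_nil : PL [] = ∅ := by
  ext w; simp [PL]

theorem faceCount_eq {m n : ℕ} {T : Finset (Fin n → ℝ)}
    (h2 : ∀ y, Pos Finset.univ 0 y → ∃ t ∈ T, Rel m Finset.univ ∅ y t)
    (h3 : ∀ t ∈ T, ∀ t' ∈ T, Rel m Finset.univ ∅ t t' → t = t') (k : ℕ) :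
    faceCount {s : ℤ | s.natAbs ≤ m} n k =
      (T.filter fun t => dval m Finset.univ ∅ t = k).card := by
  unfold faceCount
  have e : Nat.card {t // t ∈ T.filter fun t => dval m Finset.univ ∅ t = k} =
      (T.filter fun t => dval m Finset.univ ∅ t = k).card := by
    rw [Nat.card_eq_fintype_card, Fintype.card_coe]
  rw [← e]
  symm
  have hmk : ∀ t : {t // t ∈ T.filter fun t => dval m Finset.univ ∅ t = k},
      IsFace n (arrS {s : ℤ | s.natAbs ≤ m} n) {y | Rel m Finset.univ ∅ t.1 y} ∧
        faceDim n {y | Rel m Finset.univ ∅ t.1 y} = k := by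
    rintro ⟨t, ht⟩
    exact ⟨(isFace_iff _).2 ⟨t, rfl⟩, by rw [faceDim_eq]; exact (Finset.mem_filter.1 ht).2⟩
  refine Nat.card_eq_of_bijective (fun t => ⟨_, hmk t⟩) ⟨?_, ?_⟩
  · rintro ⟨t, ht⟩ ⟨t', ht'⟩ h
    have h : {y | Rel m Finset.univ ∅ t y} = {y | Rel m Finset.univ ∅ t' y} := congrArg Subtype.val h
    have h4 : t' ∈ {y | Rel m Finset.univ ∅ t y} := by
      rw [h]; exact Rel.refl _ _ _ t'
    exact Subtype.ext (h3 t (Finset.mem_filter.1 ht).1 t' (Finset.mem_filter.1 ht').1 h4)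
  · rintro ⟨F, hF, hd⟩
    obtain ⟨x, rfl⟩ := (isFace_iff F).1 hF
    obtain ⟨C, hC⟩ : ∃ C : ℝ, ∀ i, -C < x i := by
      refine ⟨∑ i, |x i| + 1, fun i => ?_⟩
      have : |x i| ≤ ∑ i, |x i| := Finset.single_le_sum (f := fun i => |x i|) (fun i _ => abs_nonneg _)
        (Finset.mem_univ i)
      have := neg_abs_le (x i)
      linarith
    have hR : Rel m Finset.univ ∅ x ((fun z => z + C) ∘ x) :=
      rel_phi (fun a b h => by simpa using h) (fun a s => by ring) (by simp) x
    obtain ⟨t, ht, hRt⟩ := h2 ((fun z => z + C) ∘ x) (fun i _ => by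
      have := hC i
      simp only [Function.comp]; linarith)
    have hR' := hR.trans hRt
    have hset : {y | Rel m Finset.univ ∅ t y} = {y | Rel m Finset.univ ∅ x y} := by
      ext y
      exact ⟨fun h => hR'.trans h, fun h => hR'.symm.trans h⟩
    refine ⟨⟨t, Finset.mem_filter.2 ⟨ht, ?_⟩⟩, Subtype.ext hset⟩
    rw [← faceDim_eq, hset, hd]

theorem dval_le {m n : ℕ} (x : Fin n → ℝ) : dval m Finset.univ ∅ x ≤ n := by
  rw [← finrank_dirSub]
  exact (Submodule.finrank_le _).trans (by simp)

theorem FGF_eq {m : ℕ} (hm : 0 < m) {G : PowerSeries (Polynomial ℚ)} (hG : G = Phi m G) :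
    FGF {s : ℤ | s.natAbs ≤ m} = G := by
  ext1 n
  obtain ⟨p, ⟨T, h1, h2, h3, h4⟩, hp⟩ := main_count (ι := Fin n) hm hG _ _ Finset.univ 0 [] rfl rfl
    ⟨by simp, by simp⟩
  rw [PL_nil] at h2 h3 h4
  rw [FGF, PowerSeries.coeff_mk]
  have hsum : ∑ k ∈ Finset.range (n + 1), (faceCount {s : ℤ | s.natAbs ≤ m} n k : ℚ) •
      (Polynomial.X : Polynomial ℚ) ^ k = p := by
    rw [← h4, ← Finset.sum_fiberwise_of_maps_to (s := T) (t := Finset.range (n + 1))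
      (g := fun t => dval m Finset.univ ∅ t)
      (fun t _ => Finset.mem_range.2 (Nat.lt_succ_of_le (dval_le t)))]
    refine Finset.sum_congr rfl fun k _ => ?_
    rw [faceCount_eq h2 h3, Finset.sum_congr rfl
      (fun t ht => by rw [(Finset.mem_filter.1 ht).2] : ∀ t ∈ T.filter
        (fun t => dval m Finset.univ ∅ t = k), (Polynomial.X : Polynomial ℚ) ^
          dval m Finset.univ ∅ t = Polynomial.X ^ k), Finset.sum_const, Nat.cast_smul_eq_nsmul]
  have hn : (n.factorial : ℚ) ≠ 0 := by exact_mod_cast n.factorial_ne_zero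
  rw [hsum]
  simp only [List.length_nil, pow_zero, one_mul, FL, List.map_nil, List.prod_nil, mul_one, fc,
    Finset.card_univ, Fintype.card_fin] at hp
  rw [hp, ← mul_assoc, ← Polynomial.C_mul, inv_mul_cancel₀ hn, Polynomial.C_1, one_mul]

end Faces

/-- Proposition 5.5. The face generating function
`G = F_{[-m;m]}(x,u)` of the `m`-Catalan arrangements is the unique formal power series in
`ℚ[u][[x]]` satisfying `G = e^{-x} + (1+u)(1-e^{-x})·G^{m+1}`. -/
theorem catalan_face_gf (m : ℕ) (hm : 0 < m) :
    FGF {s : ℤ | s.natAbs ≤ m} =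
      EexpNeg + (1 + Useries) * (1 - EexpNeg) * (FGF {s : ℤ | s.natAbs ≤ m}) ^ (m + 1) ∧
    ∀ G : PowerSeries (Polynomial ℚ),
      G = EexpNeg + (1 + Useries) * (1 - EexpNeg) * G ^ (m + 1) →
      G = FGF {s : ℤ | s.natAbs ≤ m} := by
  obtain ⟨G, hG⟩ := phi_exists m
  rw [FGF_eq hm hG]
  exact ⟨hG, fun H hH => phi_unique m H G hH hG⟩

end Braid
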